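/- Let f: ℝ → ℝ be real and even, with Fourier transform f̂ continuous and supported in [−1, 1]. Then, as q → ∞ through odd primes, the character average ⟨(W_f^osc)²⟩_q converges to ∫_{−1}^{1} |u| · f̂(u)² du. -/

import Mathlib

open ArithmeticFunction Filter

/-- The oscillatory part of the linear statistic:
`W_f^osc(χ) = -(1/log q) ∑ₙ (Λ(n)/√n) f̂(log n/log q) (χ(n) + conj χ(n))`. -/
noncomputable def Wosc (q : ℕ) (fhat : ℝ → ℝ) (χ : DirichletCharacter ℂ q) : ℝ :=
  -(1 / Real.log q) *
    ∑' n : ℕ, Λ n / Real.sqrt n * fhat (Real.log n / Real.log q) *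
      (χ n + (starRingEnd ℂ) (χ n)).re

open scoped Classical in
/-- The average over the `q - 2` nontrivial Dirichlet characters modulo the prime `q`. -/
noncomputable def charAvg (q : ℕ) (H : DirichletCharacter ℂ q → ℝ) : ℝ :=
  (1 / (q - 2 : ℝ)) * ∑ χ ∈ Finset.univ.filter (fun χ : DirichletCharacter ℂ q => χ ≠ 1), H χ

/-- Mertens' first theorem for the von Mangoldt function. -/
theorem exists_abs_sum_vonMangoldt_div_sub_log_le :
    ∃ C : ℝ, ∀ N : ℕ, N ≠ 0 → |∑ n ∈ Finset.Ioc 0 N, Λ n / n - Real.log N| ≤ C := by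
  refine ⟨Real.log 4 + 4, fun N hN => ?_⟩
  have hN0 : (0 : ℝ) < N := by positivity
  have hlog4 : 0 ≤ Real.log 4 := Real.log_nonneg (by norm_num)
  have hfact : Real.log (N.factorial) = ∑ n ∈ Finset.Ioc 0 N, Λ n * ((N / n : ℕ) : ℝ) := by
    rw [← sum_Ioc_mul_zeta_eq_sum, vonMangoldt_mul_zeta]
    clear hN hN0
    induction N with
    | zero => simp
    | succ N ih =>
      rw [Finset.sum_Ioc_succ_top (by omega), ← ih, Nat.factorial_succ, Nat.cast_mul,
        Real.log_mul (by positivity) (by positivity), add_comm]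
      simp [log_apply]
  have hlower := Stirling.le_log_factorial_stirling hN
  have hupper : Real.log (N.factorial) ≤ N * Real.log N := by
    rw [← Real.log_pow]
    exact Real.log_le_log (by positivity) (by exact_mod_cast N.factorial_le_pow)
  have hlogN : 0 ≤ Real.log N := Real.log_natCast_nonneg N
  have hpi : 0 ≤ Real.log (2 * Real.pi) :=
    Real.log_nonneg (by nlinarith [Real.pi_gt_three])
  have hpsi : ∑ n ∈ Finset.Ioc 0 N, Λ n ≤ (Real.log 4 + 4) * N := by
    simpa [Chebyshev.psi] using Chebyshev.psi_le_const_mul_self hN0.le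
  have hmul : (N : ℝ) * ∑ n ∈ Finset.Ioc 0 N, Λ n / n = ∑ n ∈ Finset.Ioc 0 N, Λ n * (N / n) := by
    rw [Finset.mul_sum]
    exact Finset.sum_congr rfl fun n _ => by ring
  have h1 : ∑ n ∈ Finset.Ioc 0 N, Λ n * ((N / n : ℕ) : ℝ) ≤
      ∑ n ∈ Finset.Ioc 0 N, Λ n * (N / n) :=
    Finset.sum_le_sum fun n _ => mul_le_mul_of_nonneg_left Nat.cast_div_le vonMangoldt_nonneg
  have h2 : ∑ n ∈ Finset.Ioc 0 N, Λ n * (N / n : ℝ) ≤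
      ∑ n ∈ Finset.Ioc 0 N, Λ n * ((N / n : ℕ) : ℝ) + ∑ n ∈ Finset.Ioc 0 N, Λ n := by
    rw [← Finset.sum_add_distrib]
    refine Finset.sum_le_sum fun n hn => ?_
    have : (N / n : ℝ) ≤ ((N / n : ℕ) : ℝ) + 1 := by
      rw [← Nat.floor_div_eq_div (K := ℝ)]
      exact (Nat.lt_floor_add_one _).le
    nlinarith [vonMangoldt_nonneg (n := n)]
  set A := ∑ n ∈ Finset.Ioc 0 N, Λ n / n
  rw [abs_le]
  constructor
  · refine le_of_mul_le_mul_left ?_ hN0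
    nlinarith
  · refine le_of_mul_le_mul_left ?_ hN0
    nlinarith

theorem tendsto_log_natCast_atTop : Tendsto (fun q : ℕ => Real.log q) atTop atTop :=
  Real.tendsto_log_atTop.comp tendsto_natCast_atTop_atTop

theorem tendsto_sum_vonMangoldt_div_indicator {t : ℝ} (ht0 : 0 ≤ t) (ht1 : t ≤ 1) :
    Tendsto (fun q : ℕ => (1 / Real.log q) *
      ∑ n ∈ Finset.Ioc 0 q, Λ n / n * (if Real.log n / Real.log q ≤ t then 1 else 0))
      atTop (nhds t) := by
  obtain ⟨C, hC⟩ := exists_abs_sum_vonMangoldt_div_sub_log_le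
  rw [tendsto_iff_norm_sub_tendsto_zero]
  refine squeeze_zero' (g := fun q : ℕ => (C + Real.log 2) / Real.log q)
    (Eventually.of_forall fun q => norm_nonneg _) ?_
    (tendsto_log_natCast_atTop.const_div_atTop _)
  filter_upwards [eventually_ge_atTop 2] with q hq
  have hq' : (2 : ℝ) ≤ q := by exact_mod_cast hq
  have hq0 : (0 : ℝ) < q := by linarith
  have hL : 0 < Real.log q := Real.log_pos (by linarith)
  set x : ℝ := (q : ℝ) ^ t with hx
  have hx1 : 1 ≤ x := Real.one_le_rpow (by linarith) ht0
  have hlogx : Real.log x = t * Real.log q := Real.log_rpow hq0 t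
  have hxq : x ≤ q := by
    simpa using Real.rpow_le_rpow_of_exponent_le (by linarith : (1 : ℝ) ≤ q) ht1
  have hN : ⌊x⌋₊ ≠ 0 := (Nat.floor_pos.mpr hx1).ne'
  have hN1 : (1 : ℝ) ≤ ⌊x⌋₊ := by exact_mod_cast Nat.one_le_iff_ne_zero.mpr hN
  have hsum : ∑ n ∈ Finset.Ioc 0 q, Λ n / n * (if Real.log n / Real.log q ≤ t then 1 else 0) =
      ∑ n ∈ Finset.Ioc 0 ⌊x⌋₊, Λ n / n := by
    simp only [mul_ite, mul_one, mul_zero]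
    rw [← Finset.sum_filter]
    refine Finset.sum_congr ?_ fun _ _ => rfl
    ext n
    simp only [Finset.mem_filter, Finset.mem_Ioc, Nat.le_floor_iff (by linarith : 0 ≤ x)]
    constructor
    · rintro ⟨⟨h1, h2⟩, h3⟩
      refine ⟨h1, ?_⟩
      rw [div_le_iff₀ hL, ← hlogx] at h3
      exact (Real.log_le_log_iff (by exact_mod_cast h1) (by linarith)).mp h3
    · rintro ⟨h1, h2⟩
      refine ⟨⟨h1, by exact_mod_cast h2.trans hxq⟩, ?_⟩
      rw [div_le_iff₀ hL, ← hlogx]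
      exact Real.log_le_log (by exact_mod_cast h1) h2
  have hlog1 : Real.log ⌊x⌋₊ ≤ t * Real.log q := by
    rw [← hlogx]
    exact Real.log_le_log (by linarith) (Nat.floor_le (by linarith))
  have hlog2 : t * Real.log q ≤ Real.log ⌊x⌋₊ + Real.log 2 := by
    rw [← hlogx, ← Real.log_mul (by positivity) (by norm_num)]
    refine Real.log_le_log (by linarith) ?_
    linarith [Nat.lt_floor_add_one x]
  have hA := abs_le.mp (hC _ hN)
  rw [hsum, Real.norm_eq_abs, le_div_iff₀ hL]
  nth_rewrite 2 [← abs_of_pos hL]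
  rw [← abs_mul, sub_mul, one_div, mul_right_comm, inv_mul_cancel₀ hL.ne', one_mul, abs_le]
  have := Real.log_nonneg (by norm_num : (1 : ℝ) ≤ 2)
  constructor <;> linarith [hA.1, hA.2]

/-- A step function on a uniform partition of `(0, 1]` takes the left-endpoint value. -/
theorem sum_step_eq {M : ℕ} (hM : 0 < M) (k : ℝ → ℝ) {u : ℝ} (hu0 : 0 < u) (hu1 : u ≤ 1) :
    ∃ i < M, (i / M : ℝ) < u ∧ u ≤ ((i + 1 : ℕ) / M : ℝ) ∧
      ∑ j ∈ Finset.range M, k (j / M) * ((if u ≤ ((j + 1 : ℕ) / M : ℝ) then 1 else 0) -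
        (if u ≤ (j / M : ℝ) then 1 else 0)) = k (i / M) := by
  have hM' : (0 : ℝ) < M := by exact_mod_cast hM
  have hpos : 0 < ⌈M * u⌉₊ := Nat.ceil_pos.mpr (by positivity)
  obtain ⟨i, hi⟩ : ∃ i, ⌈M * u⌉₊ = i + 1 := ⟨⌈M * u⌉₊ - 1, by omega⟩
  have key : ∀ j : ℕ, u ≤ (j / M : ℝ) ↔ i + 1 ≤ j := fun j => by
    rw [le_div_iff₀ hM', mul_comm, ← Nat.ceil_le, hi]
  have hiM : i < M := by
    have := (key M).mp (by rw [div_self hM'.ne']; exact hu1)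
    omega
  refine ⟨i, hiM, ?_, (key _).mpr le_rfl, ?_⟩
  · rw [← not_le, key]; omega
  · rw [Finset.sum_eq_single_of_mem i (Finset.mem_range.mpr hiM)]
    · simp only [key]
      simp
    · intro j _ hj
      simp only [key]
      by_cases h : i + 1 ≤ j
      · simp [h, h.trans (Nat.le_succ j)]
      · have : ¬ (i + 1 ≤ j + 1) := by omega
        simp [h, this]

/-- `(1 / log q) ∑_{n ≤ q} Λ(n)/n k(log n / log q)` tends to `∫₀¹ k`. -/
theorem tendsto_sum_vonMangoldt_div_mul {k : ℝ → ℝ} (hk : Continuous k) :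
    Tendsto (fun q : ℕ => (1 / Real.log q) *
      ∑ n ∈ Finset.Ioc 0 q, Λ n / n * k (Real.log n / Real.log q))
      atTop (nhds (∫ u in (0 : ℝ)..1, k u)) := by
  rw [Metric.tendsto_atTop']
  intro ε hε
  have huc : UniformContinuousOn k (Set.Icc 0 1) :=
    isCompact_Icc.uniformContinuousOn_of_continuous hk.continuousOn
  obtain ⟨δ, hδ, hkδ⟩ := Metric.uniformContinuousOn_iff.mp huc (ε / 5) (by positivity)
  obtain ⟨m, hm⟩ := exists_nat_one_div_lt hδ
  set M := m + 1 with hMdef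
  have hM : 0 < M := by omega
  have hM' : (0 : ℝ) < M := by exact_mod_cast hM
  have hMδ : (1 / M : ℝ) < δ := by simpa [hMdef] using hm
  have hclose : ∀ i : ℕ, i < M → ∀ u : ℝ, (i / M : ℝ) ≤ u → u ≤ ((i + 1 : ℕ) / M : ℝ) →
      |k u - k (i / M)| ≤ ε / 5 := by
    intro i hi u h1 h2
    have h0 : (0 : ℝ) ≤ i / M := by positivity
    have h3 : ((i + 1 : ℕ) / M : ℝ) ≤ 1 := by
      rw [div_le_one hM']; exact_mod_cast hi
    have h4 : ((i + 1 : ℕ) / M : ℝ) = i / M + 1 / M := by push_cast; ring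
    refine (hkδ u ⟨by linarith, by linarith⟩ (i / M) ⟨h0, by linarith⟩ ?_).le
    rw [Real.dist_eq, abs_lt]
    constructor <;> linarith
  have hint : |∑ j ∈ Finset.range M, k (j / M) * (((j + 1 : ℕ) / M : ℝ) - j / M) -
      ∫ u in (0 : ℝ)..1, k u| ≤ ε / 5 := by
    have hadj := intervalIntegral.sum_integral_adjacent_intervals (f := k)
      (μ := MeasureTheory.volume) (a := fun j : ℕ => (j / M : ℝ)) (n := M)
      (fun j _ => hk.intervalIntegrable _ _)
    simp only [Nat.cast_zero, zero_div, div_self hM'.ne'] at hadj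
    rw [← hadj, ← Finset.sum_sub_distrib]
    refine (Finset.abs_sum_le_sum_abs _ _).trans ?_
    have hterm : ∀ j ∈ Finset.range M, |k (j / M) * (((j + 1 : ℕ) / M : ℝ) - j / M) -
        ∫ u in (j / M : ℝ)..((j + 1 : ℕ) / M : ℝ), k u| ≤ ε / 5 * (1 / M) := by
      intro j hj
      have h4 : ((j + 1 : ℕ) / M : ℝ) - j / M = 1 / M := by push_cast; ring
      have hconst : k (j / M) * (((j + 1 : ℕ) / M : ℝ) - j / M) =
          ∫ u in (j / M : ℝ)..((j + 1 : ℕ) / M : ℝ), k (j / M) := by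
        rw [intervalIntegral.integral_const, smul_eq_mul, mul_comm]
      have hle : (j / M : ℝ) ≤ ((j + 1 : ℕ) / M : ℝ) := by
        have : (0 : ℝ) ≤ 1 / M := by positivity
        linarith
      rw [hconst, ← intervalIntegral.integral_sub (by simp) (hk.intervalIntegrable _ _)]
      have := intervalIntegral.norm_integral_le_of_norm_le_const (a := (j / M : ℝ))
        (b := ((j + 1 : ℕ) / M : ℝ)) (f := fun u => k (j / M) - k u) (C := ε / 5)
        (fun u hu => by
          rw [Set.uIoc_of_le hle] at hu
          rw [Real.norm_eq_abs, abs_sub_comm]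
          exact hclose j (Finset.mem_range.mp hj) u hu.1.le hu.2)
      rwa [h4, abs_of_nonneg (by positivity : (0 : ℝ) ≤ 1 / M)] at this
    refine (Finset.sum_le_sum hterm).trans (le_of_eq ?_)
    rw [Finset.sum_const, Finset.card_range, nsmul_eq_mul]
    field_simp
  have hlim1 := tendsto_sum_vonMangoldt_div_indicator zero_le_one le_rfl
  have hlimM : Tendsto (fun q : ℕ => ∑ j ∈ Finset.range M, k (j / M) *
      ((1 / Real.log q) * ∑ n ∈ Finset.Ioc 0 q,
        Λ n / n * (if Real.log n / Real.log q ≤ ((j + 1 : ℕ) / M : ℝ) then 1 else 0) -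
      (1 / Real.log q) * ∑ n ∈ Finset.Ioc 0 q,
        Λ n / n * (if Real.log n / Real.log q ≤ (j / M : ℝ) then 1 else 0))) atTop
      (nhds (∑ j ∈ Finset.range M, k (j / M) * (((j + 1 : ℕ) / M : ℝ) - j / M))) := by
    refine tendsto_finsetSum _ fun j hj => (Tendsto.sub ?_ ?_).const_mul _
    · refine tendsto_sum_vonMangoldt_div_indicator (by positivity) ?_
      rw [div_le_one hM']
      exact_mod_cast Finset.mem_range.mp hj
    · refine tendsto_sum_vonMangoldt_div_indicator (by positivity) ?_
      rw [div_le_one hM']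
      exact_mod_cast (Finset.mem_range.mp hj).le
  obtain ⟨N, hN⟩ := eventually_atTop.mp
    ((hlim1.eventually (gt_mem_nhds one_lt_two)).and
      ((Metric.tendsto_nhds.mp hlimM (ε / 5) (by positivity)).and (eventually_ge_atTop 2)))
  refine ⟨N, fun q hq => ?_⟩
  obtain ⟨hT1, hTM, hq2⟩ := hN q hq.le
  have hL : 0 < Real.log q := Real.log_pos (by exact_mod_cast hq2)
  have hu1 : ∀ n ∈ Finset.Ioc 0 q, Real.log n / Real.log q ≤ 1 := fun n hn => by
    rw [Finset.mem_Ioc] at hn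
    rw [div_le_one hL]
    exact Real.log_le_log (by exact_mod_cast hn.1) (by exact_mod_cast hn.2)
  have hstep : |(1 / Real.log q) * ∑ n ∈ Finset.Ioc 0 q, Λ n / n * k (Real.log n / Real.log q) -
      ∑ j ∈ Finset.range M, k (j / M) *
      ((1 / Real.log q) * ∑ n ∈ Finset.Ioc 0 q,
        Λ n / n * (if Real.log n / Real.log q ≤ ((j + 1 : ℕ) / M : ℝ) then 1 else 0) -
      (1 / Real.log q) * ∑ n ∈ Finset.Ioc 0 q,
        Λ n / n * (if Real.log n / Real.log q ≤ (j / M : ℝ) then 1 else 0))| ≤ ε / 5 * 2 := by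
    have heq : ∑ j ∈ Finset.range M, k (j / M) *
      ((1 / Real.log q) * ∑ n ∈ Finset.Ioc 0 q,
        Λ n / n * (if Real.log n / Real.log q ≤ ((j + 1 : ℕ) / M : ℝ) then 1 else 0) -
      (1 / Real.log q) * ∑ n ∈ Finset.Ioc 0 q,
        Λ n / n * (if Real.log n / Real.log q ≤ (j / M : ℝ) then 1 else 0)) =
      (1 / Real.log q) * ∑ n ∈ Finset.Ioc 0 q, Λ n / n * ∑ j ∈ Finset.range M, k (j / M) *
        ((if Real.log n / Real.log q ≤ ((j + 1 : ℕ) / M : ℝ) then 1 else 0) -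
        (if Real.log n / Real.log q ≤ (j / M : ℝ) then 1 else 0)) := by
      simp only [Finset.mul_sum, ← Finset.sum_sub_distrib]
      rw [Finset.sum_comm]
      exact Finset.sum_congr rfl fun n _ => Finset.sum_congr rfl fun j _ => by ring
    rw [heq, ← mul_sub, ← Finset.sum_sub_distrib, abs_mul, abs_of_pos (by positivity)]
    have hbound : |∑ n ∈ Finset.Ioc 0 q, (Λ n / n * k (Real.log n / Real.log q) -
        Λ n / n * ∑ j ∈ Finset.range M, k (j / M) *
        ((if Real.log n / Real.log q ≤ ((j + 1 : ℕ) / M : ℝ) then 1 else 0) -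
        (if Real.log n / Real.log q ≤ (j / M : ℝ) then 1 else 0)))| ≤
        ∑ n ∈ Finset.Ioc 0 q, Λ n / n * (if Real.log n / Real.log q ≤ 1 then 1 else 0) *
          (ε / 5) := by
      refine (Finset.abs_sum_le_sum_abs _ _).trans (Finset.sum_le_sum fun n hn => ?_)
      have hw : 0 ≤ Λ n / n := div_nonneg vonMangoldt_nonneg n.cast_nonneg
      rw [← mul_sub, abs_mul, abs_of_nonneg hw, if_pos (hu1 n hn), mul_one]
      rcases eq_or_ne n 1 with rfl | hn1
      · simp
      have hn2 : 1 < n := by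
        have := (Finset.mem_Ioc.mp hn).1
        omega
      have hu0 : 0 < Real.log n / Real.log q :=
        div_pos (Real.log_pos (by exact_mod_cast hn2)) hL
      obtain ⟨i, hi, h1, h2, h3⟩ := sum_step_eq hM k hu0 (hu1 n hn)
      rw [h3]
      exact mul_le_mul_of_nonneg_left (hclose i hi _ h1.le h2) hw
    rw [← Finset.sum_mul] at hbound
    calc _ ≤ _ := mul_le_mul_of_nonneg_left hbound (by positivity)
      _ ≤ _ := by
        rw [← mul_assoc, mul_comm]
        exact mul_le_mul_of_nonneg_left hT1.le (by positivity)
  rw [Real.dist_eq] at hTM ⊢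
  have h1 := abs_le.mp hstep
  have h2 := abs_lt.mp hTM
  have h3 := abs_le.mp hint
  rw [abs_lt]
  constructor <;> linarith [h1.1, h1.2, h2.1, h2.2, h3.1, h3.2]

/-- Prime powers `p ^ k` with `k ≥ 2` contribute a bounded amount to `∑ Λ(n)/n`. -/
theorem exists_sum_vonMangoldt_nonprime_div_le :
    ∃ S : ℝ, ∀ N : ℕ, ∑ n ∈ Finset.Ioc 0 N, (if n.Prime then 0 else Λ n) / n ≤ S := by
  have hs := vonMangoldt.summable_residueClass_non_primes_div (q := 1) 0
  have hres : ∀ n, vonMangoldt.residueClass (0 : ZMod 1) n = Λ n := fun n =>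
    Set.indicator_of_mem (s := {n : ℕ | (n : ZMod 1) = 0}) (Subsingleton.elim _ _) _
  simp only [hres] at hs
  refine ⟨_, fun N => hs.sum_le_tsum (Finset.Ioc 0 N) fun n _ => ?_⟩
  split_ifs
  · simp
  · exact div_nonneg vonMangoldt_nonneg n.cast_nonneg

theorem exists_abs_le_on_unitInterval {g : ℝ → ℝ} (hg : Continuous g) :
    ∃ G : ℝ, 0 ≤ G ∧ ∀ u ∈ Set.Icc (0 : ℝ) 1, |g u| ≤ G := by
  obtain ⟨G, hG⟩ := isCompact_Icc.exists_bound_of_continuousOn (s := Set.Icc (0 : ℝ) 1)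
    hg.continuousOn
  exact ⟨G, (norm_nonneg _).trans (hG 0 (by simp)), hG⟩

theorem log_div_log_mem_unitInterval {n q : ℕ} (hn : n ∈ Finset.Ioc 0 q) :
    Real.log n / Real.log q ∈ Set.Icc (0 : ℝ) 1 := by
  rw [Finset.mem_Ioc] at hn
  exact ⟨div_nonneg (Real.log_natCast_nonneg _) (Real.log_natCast_nonneg _),
    div_le_one_of_le₀ (Real.log_le_log (by exact_mod_cast hn.1) (by exact_mod_cast hn.2))
      (Real.log_natCast_nonneg _)⟩

/-- The diagonal contribution. -/
theorem tendsto_sum_vonMangoldt_sq_div_mul {h : ℝ → ℝ} (hh : Continuous h) :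
    Tendsto (fun q : ℕ => (1 / Real.log q ^ 2) *
      ∑ n ∈ Finset.Ioc 0 q, Λ n ^ 2 / n * h (Real.log n / Real.log q))
      atTop (nhds (∫ u in (0 : ℝ)..1, u * h u)) := by
  obtain ⟨H, hH0, hH⟩ := exists_abs_le_on_unitInterval hh
  obtain ⟨S, hS⟩ := exists_sum_vonMangoldt_nonprime_div_le
  have hmain := tendsto_sum_vonMangoldt_div_mul (k := fun u => u * h u) (by fun_prop)
  have hdiff : Tendsto (fun q : ℕ => (1 / Real.log q) *
      ∑ n ∈ Finset.Ioc 0 q, Λ n / n *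
        (Real.log n / Real.log q * h (Real.log n / Real.log q)) -
      (1 / Real.log q ^ 2) *
      ∑ n ∈ Finset.Ioc 0 q, Λ n ^ 2 / n * h (Real.log n / Real.log q)) atTop (nhds 0) := by
    rw [tendsto_zero_iff_norm_tendsto_zero]
    refine squeeze_zero' (g := fun q : ℕ => (H * S) / Real.log q)
      (Eventually.of_forall fun q => norm_nonneg _) ?_
      (tendsto_log_natCast_atTop.const_div_atTop _)
    filter_upwards [eventually_ge_atTop 2] with q hq
    have hL : 0 < Real.log q := Real.log_pos (by exact_mod_cast hq)
    have heq : (1 / Real.log q) * ∑ n ∈ Finset.Ioc 0 q, Λ n / n *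
        (Real.log n / Real.log q * h (Real.log n / Real.log q)) -
      (1 / Real.log q ^ 2) *
        ∑ n ∈ Finset.Ioc 0 q, Λ n ^ 2 / n * h (Real.log n / Real.log q) =
      (1 / Real.log q ^ 2) * ∑ n ∈ Finset.Ioc 0 q,
        Λ n * (Real.log n - Λ n) / n * h (Real.log n / Real.log q) := by
      rw [Finset.mul_sum, Finset.mul_sum, Finset.mul_sum, ← Finset.sum_sub_distrib]
      refine Finset.sum_congr rfl fun n _ => ?_
      field_simp
    rw [heq, Real.norm_eq_abs, abs_mul, abs_of_pos (by positivity)]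
    have hbound : |∑ n ∈ Finset.Ioc 0 q,
        Λ n * (Real.log n - Λ n) / n * h (Real.log n / Real.log q)| ≤
        ∑ n ∈ Finset.Ioc 0 q, (Real.log q * H) * ((if n.Prime then 0 else Λ n) / n) := by
      refine (Finset.abs_sum_le_sum_abs _ _).trans (Finset.sum_le_sum fun n hn => ?_)
      have hn' := Finset.mem_Ioc.mp hn
      by_cases hp : n.Prime
      · simp [hp, vonMangoldt_apply_prime hp]
      · rw [if_neg hp, abs_mul]
        have h1 : 0 ≤ Real.log n - Λ n := sub_nonneg.mpr vonMangoldt_le_log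
        have h2 : Real.log n - Λ n ≤ Real.log q := by
          have := Real.log_le_log (by exact_mod_cast hn'.1)
            (by exact_mod_cast hn'.2 : (n : ℝ) ≤ q)
          linarith [vonMangoldt_nonneg (n := n)]
        have h3 : 0 ≤ Λ n / n := div_nonneg vonMangoldt_nonneg n.cast_nonneg
        have h4 : Λ n * (Real.log n - Λ n) / n = (Λ n / n) * (Real.log n - Λ n) := by ring
        rw [h4, abs_of_nonneg (mul_nonneg h3 h1)]
        calc _ ≤ (Λ n / n) * Real.log q * H := by
              gcongr
              exact hH _ (log_div_log_mem_unitInterval hn)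
          _ = _ := by ring
    rw [← Finset.mul_sum] at hbound
    calc _ ≤ (1 / Real.log q ^ 2) * ((Real.log q * H) * S) := by
          gcongr
          refine hbound.trans ?_
          gcongr
          exact hS q
      _ = _ := by field_simp
  simpa using hmain.sub hdiff

theorem sum_one_div_sqrt_le (N : ℕ) :
    ∑ n ∈ Finset.Ioc 0 N, 1 / Real.sqrt n ≤ 2 * Real.sqrt N := by
  induction N with
  | zero => simp
  | succ N ih =>
    rw [Finset.sum_Ioc_succ_top (by omega)]
    refine (add_le_add_left ih _).trans ?_
    have h1 : 0 < Real.sqrt ((N + 1 : ℕ) : ℝ) := Real.sqrt_pos.mpr (by positivity)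
    have h2 := Real.sq_sqrt (N.cast_nonneg : (0 : ℝ) ≤ N)
    have h3 := Real.sq_sqrt ((N + 1).cast_nonneg : (0 : ℝ) ≤ ((N + 1 : ℕ) : ℝ))
    rw [← sub_nonneg]
    have h4 : 2 * Real.sqrt ((N + 1 : ℕ) : ℝ) -
        (2 * Real.sqrt N + 1 / Real.sqrt ((N + 1 : ℕ) : ℝ)) =
        (Real.sqrt ((N + 1 : ℕ) : ℝ) - Real.sqrt N) ^ 2 / Real.sqrt ((N + 1 : ℕ) : ℝ) := by
      field_simp
      push_cast at h3 ⊢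
      nlinarith
    rw [h4]
    positivity

theorem sum_one_div_sqrt_filter_le (N : ℕ) {y : ℝ} (hy : 0 ≤ y) :
    ∑ n ∈ (Finset.Ioc 0 N).filter (fun n : ℕ => (n : ℝ) ≤ y), 1 / Real.sqrt n ≤ 2 * Real.sqrt y := by
  calc _ ≤ ∑ n ∈ Finset.Ioc 0 ⌊y⌋₊, 1 / Real.sqrt n := by
        refine Finset.sum_le_sum_of_subset_of_nonneg (fun n hn => ?_)
          (fun _ _ _ => by positivity)
        simp only [Finset.mem_filter, Finset.mem_Ioc] at hn ⊢
        exact ⟨hn.1.1, Nat.le_floor hn.2⟩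
    _ ≤ _ := (sum_one_div_sqrt_le _).trans (by gcongr; exact Nat.floor_le hy)

/-- If `g` is continuous and `g 1 = 0`, then `g (log n / log q)` is small unless `n` is smaller
than `q` by a power of `q`. -/
theorem exists_abs_comp_log_div_log_le {g : ℝ → ℝ} (hg : Continuous g) (hg1 : g 1 = 0)
    {ε : ℝ} (hε : 0 < ε) :
    ∃ θ : ℝ, θ < 1 ∧ ∀ q : ℕ, 2 ≤ q → ∀ n ∈ Finset.Ioc 0 q,
      (q : ℝ) ^ θ < n → |g (Real.log n / Real.log q)| ≤ ε := by
  obtain ⟨δ, hδ, hgδ⟩ := Metric.continuousAt_iff.mp (hg.continuousAt (x := 1)) ε hε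
  refine ⟨1 - δ, by linarith, fun q hq n hn hlt => ?_⟩
  have hL : 0 < Real.log q := Real.log_pos (by exact_mod_cast hq)
  have hq0 : (0 : ℝ) < q := by positivity
  have hu := log_div_log_mem_unitInterval hn
  have h1 : 1 - δ < Real.log n / Real.log q := by
    rw [lt_div_iff₀ hL, ← Real.log_rpow hq0]
    exact Real.log_lt_log (by positivity) hlt
  have := hgδ (x := Real.log n / Real.log q) (by
    rw [Real.dist_eq, abs_lt]
    constructor <;> linarith [hu.2])
  rw [hg1, Real.dist_eq, sub_zero] at this
  exact this.le

theorem tendsto_natCast_rpow_sub_one {θ : ℝ} (hθ : θ < 1) :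
    Tendsto (fun q : ℕ => (q : ℝ) ^ θ / q) atTop (nhds 0) := by
  refine ((tendsto_rpow_neg_atTop (sub_pos.mpr hθ)).comp
    tendsto_natCast_atTop_atTop).congr' ?_
  filter_upwards [eventually_gt_atTop 0] with q hq
  have hq0 : (0 : ℝ) < q := by exact_mod_cast hq
  simp only [Function.comp_apply]
  rw [neg_sub, Real.rpow_sub_one hq0.ne']

/-- The bound used for the trivial character. -/
theorem tendsto_sum_abs_div_sqrt {g : ℝ → ℝ} (hg : Continuous g) (hg1 : g 1 = 0) :
    Tendsto (fun q : ℕ => (1 / Real.sqrt q) *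
      ∑ n ∈ Finset.Ioc 0 q, |g (Real.log n / Real.log q)| / Real.sqrt n) atTop (nhds 0) := by
  obtain ⟨G, hG0, hG⟩ := exists_abs_le_on_unitInterval hg
  rw [Metric.tendsto_nhds]
  intro ε hε
  obtain ⟨θ, hθ, hθg⟩ := exists_abs_comp_log_div_log_le hg hg1 (by positivity : 0 < ε / 4)
  have hlim : Tendsto (fun q : ℕ => ε / 2 + 2 * G * Real.sqrt ((q : ℝ) ^ θ / q)) atTop
      (nhds (ε / 2)) := by
    simpa using (((tendsto_natCast_rpow_sub_one hθ).sqrt).const_mul (2 * G)).const_add (ε / 2)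
  filter_upwards [hlim.eventually (gt_mem_nhds (half_lt_self hε)), eventually_ge_atTop 2]
    with q hlt hq
  have hq0 : (0 : ℝ) < q := by positivity
  have hs : 0 < Real.sqrt q := Real.sqrt_pos.mpr hq0
  rw [Real.dist_eq, sub_zero, abs_of_nonneg (by positivity)]
  refine lt_of_le_of_lt ?_ hlt
  have hbound : ∑ n ∈ Finset.Ioc 0 q, |g (Real.log n / Real.log q)| / Real.sqrt n ≤
      ∑ n ∈ Finset.Ioc 0 q, ((ε / 4) * (1 / Real.sqrt n) +
        (if (n : ℝ) ≤ (q : ℝ) ^ θ then G * (1 / Real.sqrt n) else 0)) := by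
    refine Finset.sum_le_sum fun n hn => ?_
    have h0 : 0 ≤ 1 / Real.sqrt n := by positivity
    rw [div_eq_mul_one_div]
    split_ifs with h
    · have := mul_le_mul_of_nonneg_right (hG _ (log_div_log_mem_unitInterval hn)) h0
      have : 0 ≤ ε / 4 * (1 / Real.sqrt n) := by positivity
      linarith
    · rw [add_zero]
      exact mul_le_mul_of_nonneg_right (hθg q hq n hn (not_le.mp h)) h0
  rw [Finset.sum_add_distrib, ← Finset.mul_sum, ← Finset.sum_filter, ← Finset.mul_sum] at hbound
  have h1 := sum_one_div_sqrt_le q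
  have h2 := sum_one_div_sqrt_filter_le q (y := (q : ℝ) ^ θ) (by positivity)
  have h3 : ∑ n ∈ Finset.Ioc 0 q, |g (Real.log n / Real.log q)| / Real.sqrt n ≤
      (ε / 4) * (2 * Real.sqrt q) + G * (2 * Real.sqrt ((q : ℝ) ^ θ)) :=
    hbound.trans (add_le_add (mul_le_mul_of_nonneg_left h1 (by positivity))
      (mul_le_mul_of_nonneg_left h2 hG0))
  calc _ ≤ (1 / Real.sqrt q) *
        ((ε / 4) * (2 * Real.sqrt q) + G * (2 * Real.sqrt ((q : ℝ) ^ θ))) := by gcongr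
    _ = _ := by
      rw [Real.sqrt_div' _ hq0.le]
      field_simp
      ring

/-- Pairs `n, m ≤ y` with `n m ≡ 1 mod q` contribute little. -/
theorem sum_vonMangoldt_mul_div_sqrt_le {q : ℕ} (hq : 2 ≤ q) {y : ℝ} (hy0 : 0 ≤ y) :
    ∑ p ∈ (Finset.Ioc 0 q ×ˢ Finset.Ioc 0 q).filter
      (fun p : ℕ × ℕ => p.1 * p.2 % q = 1 ∧ (p.1 : ℝ) ≤ y ∧ (p.2 : ℝ) ≤ y),
      (Λ p.1 / Real.sqrt p.1) * (Λ p.2 / Real.sqrt p.2) ≤ 4 * Real.log q ^ 2 * (y / q) := by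
  have hq0 : (0 : ℝ) < q := by positivity
  have hL : 0 < Real.log q := Real.log_pos (by exact_mod_cast hq)
  have hsq : 0 < Real.sqrt q := Real.sqrt_pos.mpr hq0
  set P := (Finset.Ioc 0 q ×ˢ Finset.Ioc 0 q).filter
      (fun p : ℕ × ℕ => p.1 * p.2 % q = 1 ∧ (p.1 : ℝ) ≤ y ∧ (p.2 : ℝ) ≤ y) with hP
  have hPmem : ∀ p ∈ P, 0 < p.1 ∧ p.1 ≤ q ∧ 0 < p.2 ∧ p.2 ≤ q ∧ p.1 * p.2 % q = 1 ∧
      (p.1 : ℝ) ≤ y ∧ (p.2 : ℝ) ≤ y := by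
    intro p hp
    simp only [hP, Finset.mem_filter, Finset.mem_product, Finset.mem_Ioc] at hp
    tauto
  rw [← Finset.sum_subset (Finset.filter_subset (fun p : ℕ × ℕ => p.1 * p.2 ≠ 1) P)]
  swap
  · intro p hp hp'
    have h1 : p.1 * p.2 = 1 := by
      by_contra h
      exact hp' (Finset.mem_filter.mpr ⟨hp, h⟩)
    simp [Nat.eq_one_of_mul_eq_one_right h1]
  set K := ⌊y ^ 2 / q⌋₊ with hK
  have hmaps : ∀ p ∈ P.filter (fun p : ℕ × ℕ => p.1 * p.2 ≠ 1), p.1 * p.2 / q ∈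
      Finset.Ioc 0 K := by
    intro p hp
    obtain ⟨hp, hne⟩ := Finset.mem_filter.mp hp
    obtain ⟨h1, h2, h3, h4, h5, h6, h7⟩ := hPmem p hp
    rw [Finset.mem_Ioc]
    constructor
    · refine Nat.div_pos ?_ (by omega)
      by_contra hlt
      rw [Nat.mod_eq_of_lt (not_le.mp hlt)] at h5
      exact hne h5
    · refine Nat.le_floor (Nat.cast_div_le.trans ?_)
      gcongr
      push_cast
      nlinarith
  rw [← Finset.sum_fiberwise_of_maps_to hmaps]
  have hfiber : ∀ k ∈ Finset.Ioc 0 K,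
      ∑ p ∈ (P.filter (fun p : ℕ × ℕ => p.1 * p.2 ≠ 1)).filter
        (fun p : ℕ × ℕ => p.1 * p.2 / q = k),
        (Λ p.1 / Real.sqrt p.1) * (Λ p.2 / Real.sqrt p.2) ≤
      2 * Real.log q ^ 2 / Real.sqrt q * (1 / Real.sqrt k) := by
    intro k hk
    have hk0 : (0 : ℝ) < k := by exact_mod_cast (Finset.mem_Ioc.mp hk).1
    have hsk : 0 < Real.sqrt k := Real.sqrt_pos.mpr hk0
    rcases Finset.eq_empty_or_nonempty ((P.filter (fun p : ℕ × ℕ => p.1 * p.2 ≠ 1)).filter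
        (fun p : ℕ × ℕ => p.1 * p.2 / q = k)) with he | ⟨p₀, hp₀⟩
    · rw [he, Finset.sum_empty]
      positivity
    have hprod : ∀ p ∈ (P.filter (fun p : ℕ × ℕ => p.1 * p.2 ≠ 1)).filter
        (fun p : ℕ × ℕ => p.1 * p.2 / q = k), p.1 * p.2 = q * k + 1 := by
      intro p hp
      simp only [Finset.mem_filter] at hp
      have := Nat.div_add_mod (p.1 * p.2) q
      rw [hp.2, (hPmem p hp.1.1).2.2.2.2.1] at this
      exact this.symm
    have hlogN : Real.log ((q * k + 1 : ℕ) : ℝ) ≤ 2 * Real.log q := by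
      rw [← hprod p₀ hp₀]
      obtain ⟨h1, h2, h3, h4, -⟩ :=
        hPmem p₀ (Finset.mem_of_mem_filter _ (Finset.mem_of_mem_filter _ hp₀))
      have : Real.log ((p₀.1 * p₀.2 : ℕ) : ℝ) ≤ Real.log ((q : ℝ) ^ 2) := by
        refine Real.log_le_log (by exact_mod_cast Nat.mul_pos h1 h3) ?_
        rw [sq]
        exact_mod_cast Nat.mul_le_mul h2 h4
      rwa [Real.log_pow, Nat.cast_ofNat] at this
    calc _ ≤ ∑ p ∈ (P.filter (fun p : ℕ × ℕ => p.1 * p.2 ≠ 1)).filter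
          (fun p : ℕ × ℕ => p.1 * p.2 / q = k),
          Λ p.1 * (Real.log q / (Real.sqrt q * Real.sqrt k)) := by
          refine Finset.sum_le_sum fun p hp => ?_
          have hpr := hprod p hp
          obtain ⟨h1, h2, h3, h4, -⟩ :=
            hPmem p (Finset.mem_of_mem_filter _ (Finset.mem_of_mem_filter _ hp))
          have h5 : Λ p.2 ≤ Real.log q := vonMangoldt_le_log.trans
            (Real.log_le_log (by exact_mod_cast h3) (by exact_mod_cast h4))
          have h6 : (0 : ℝ) ≤ p.1 := Nat.cast_nonneg _
          rw [div_mul_div_comm, ← Real.sqrt_mul h6, mul_div_assoc, ← Real.sqrt_mul hq0.le]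
          have h7 : (q * k : ℝ) ≤ p.1 * p.2 := by
            have : q * k ≤ p.1 * p.2 := by omega
            exact_mod_cast this
          have h8 : 0 < Real.sqrt (q * k) := Real.sqrt_pos.mpr (by positivity)
          exact mul_le_mul_of_nonneg_left
            (div_le_div₀ hL.le h5 h8 (Real.sqrt_le_sqrt h7)) vonMangoldt_nonneg
      _ ≤ ∑ p ∈ (q * k + 1).divisorsAntidiagonal,
          Λ p.1 * (Real.log q / (Real.sqrt q * Real.sqrt k)) := by
          refine Finset.sum_le_sum_of_subset_of_nonneg (fun p hp => ?_)
            (fun p _ _ => mul_nonneg vonMangoldt_nonneg (by positivity))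
          exact Nat.mem_divisorsAntidiagonal.mpr ⟨hprod p hp, by omega⟩
      _ = Real.log ((q * k + 1 : ℕ) : ℝ) * (Real.log q / (Real.sqrt q * Real.sqrt k)) := by
          rw [Nat.sum_divisorsAntidiagonal
            (fun n _ => Λ n * (Real.log q / (Real.sqrt q * Real.sqrt k))), ← Finset.sum_mul,
            vonMangoldt_sum]
      _ ≤ (2 * Real.log q) * (Real.log q / (Real.sqrt q * Real.sqrt k)) := by gcongr
      _ = _ := by field_simp
  refine (Finset.sum_le_sum hfiber).trans ?_
  rw [← Finset.mul_sum]
  calc _ ≤ 2 * Real.log q ^ 2 / Real.sqrt q * (2 * Real.sqrt (y ^ 2 / q)) := by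
        gcongr
        refine (sum_one_div_sqrt_le K).trans ?_
        gcongr
        exact Nat.floor_le (by positivity)
    _ = _ := by
        rw [Real.sqrt_div' _ hq0.le, Real.sqrt_sq hy0]
        have := Real.mul_self_sqrt hq0.le
        field_simp
        rw [Real.sq_sqrt hq0.le]
        ring

/-- The off-diagonal contribution. -/
theorem tendsto_sum_offDiag {g : ℝ → ℝ} (hg : Continuous g) (hg1 : g 1 = 0) :
    Tendsto (fun q : ℕ => (1 / Real.log q ^ 2) *
      ∑ p ∈ (Finset.Ioc 0 q ×ˢ Finset.Ioc 0 q).filter (fun p : ℕ × ℕ => p.1 * p.2 % q = 1),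
        |(Λ p.1 / Real.sqrt p.1 * g (Real.log p.1 / Real.log q)) *
          (Λ p.2 / Real.sqrt p.2 * g (Real.log p.2 / Real.log q))|) atTop (nhds 0) := by
  obtain ⟨G, hG0, hG⟩ := exists_abs_le_on_unitInterval hg
  rw [Metric.tendsto_nhds]
  intro ε hε
  obtain ⟨η, hη, hηε⟩ : ∃ η : ℝ, 0 < η ∧ 4 * (η * G) < ε := by
    refine ⟨ε / (4 * G + 4), by positivity, ?_⟩
    rw [← mul_assoc, mul_div_assoc', div_mul_eq_mul_div, div_lt_iff₀ (by positivity)]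
    nlinarith
  obtain ⟨θ, hθ, hθg⟩ := exists_abs_comp_log_div_log_le hg hg1 hη
  have hlim : Tendsto (fun q : ℕ => 4 * (η * G) + 4 * G ^ 2 * ((q : ℝ) ^ θ / q)) atTop
      (nhds (4 * (η * G))) := by
    simpa using ((tendsto_natCast_rpow_sub_one hθ).const_mul (4 * G ^ 2)).const_add (4 * (η * G))
  filter_upwards [hlim.eventually (gt_mem_nhds hηε), eventually_ge_atTop 2] with q hlt hq
  have hq0 : (0 : ℝ) < q := by positivity
  have hL : 0 < Real.log q := Real.log_pos (by exact_mod_cast hq)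
  rw [Real.dist_eq, sub_zero, abs_of_nonneg
    (mul_nonneg (by positivity) (Finset.sum_nonneg fun _ _ => abs_nonneg _))]
  refine lt_of_le_of_lt ?_ hlt
  set w : ℕ × ℕ → ℝ := fun p => (Λ p.1 / Real.sqrt p.1) * (Λ p.2 / Real.sqrt p.2) with hw
  have hw0 : ∀ p, 0 ≤ w p := fun p =>
    mul_nonneg (div_nonneg vonMangoldt_nonneg (Real.sqrt_nonneg _))
      (div_nonneg vonMangoldt_nonneg (Real.sqrt_nonneg _))
  have hbound : ∑ p ∈ (Finset.Ioc 0 q ×ˢ Finset.Ioc 0 q).filter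
      (fun p : ℕ × ℕ => p.1 * p.2 % q = 1),
        |(Λ p.1 / Real.sqrt p.1 * g (Real.log p.1 / Real.log q)) *
          (Λ p.2 / Real.sqrt p.2 * g (Real.log p.2 / Real.log q))| ≤
      ∑ p ∈ (Finset.Ioc 0 q ×ˢ Finset.Ioc 0 q).filter
      (fun p : ℕ × ℕ => p.1 * p.2 % q = 1), ((η * G) * w p +
        if (p.1 : ℝ) ≤ (q : ℝ) ^ θ ∧ (p.2 : ℝ) ≤ (q : ℝ) ^ θ then G ^ 2 * w p else 0) := by
    refine Finset.sum_le_sum fun p hp => ?_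
    obtain ⟨h1, h2⟩ := Finset.mem_product.mp (Finset.mem_of_mem_filter _ hp)
    have hg1 := hG _ (log_div_log_mem_unitInterval h1)
    have hg2 := hG _ (log_div_log_mem_unitInterval h2)
    rw [mul_mul_mul_comm, abs_mul, abs_of_nonneg (hw0 p), abs_mul, mul_comm]
    have key : |g (Real.log p.1 / Real.log q)| * |g (Real.log p.2 / Real.log q)| ≤
        η * G + if (p.1 : ℝ) ≤ (q : ℝ) ^ θ ∧ (p.2 : ℝ) ≤ (q : ℝ) ^ θ then G ^ 2 else 0 := by
      split_ifs with h
      · have := mul_le_mul hg1 hg2 (abs_nonneg _) hG0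
        have : 0 ≤ η * G := by positivity
        nlinarith
      · rw [add_zero]
        rcases not_and_or.mp h with h | h
        · exact mul_le_mul (hθg q hq _ h1 (not_le.mp h)) hg2 (abs_nonneg _) hη.le
        · rw [mul_comm]
          exact mul_le_mul (hθg q hq _ h2 (not_le.mp h)) hg1 (abs_nonneg _) hη.le
    have := mul_le_mul_of_nonneg_right key (hw0 p)
    rwa [add_mul, ite_mul, zero_mul] at this
  rw [Finset.sum_add_distrib, ← Finset.mul_sum, ← Finset.sum_filter, ← Finset.mul_sum,
    Finset.filter_filter] at hbound
  have h1 := sum_vonMangoldt_mul_div_sqrt_le hq hq0.le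
  have h2 := sum_vonMangoldt_mul_div_sqrt_le hq (y := (q : ℝ) ^ θ) (by positivity)
  have h3 : ∑ p ∈ (Finset.Ioc 0 q ×ˢ Finset.Ioc 0 q).filter
      (fun p : ℕ × ℕ => p.1 * p.2 % q = 1), w p ≤ 4 * Real.log q ^ 2 * ((q : ℝ) / q) := by
    refine le_trans (le_of_eq (Finset.sum_congr (Finset.filter_congr fun p hp => ?_)
      fun _ _ => rfl)) h1
    simp only [Finset.mem_product, Finset.mem_Ioc] at hp
    simp [hp.1.2, hp.2.2]
  rw [div_self hq0.ne', mul_one] at h3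
  calc _ ≤ (1 / Real.log q ^ 2) * ((η * G) * (4 * Real.log q ^ 2) +
        G ^ 2 * (4 * Real.log q ^ 2 * ((q : ℝ) ^ θ / q))) := by
        gcongr
        refine hbound.trans (add_le_add ?_ ?_)
        · exact mul_le_mul_of_nonneg_left h3 (by positivity)
        · exact mul_le_mul_of_nonneg_left h2 (by positivity)
    _ = _ := by field_simp

theorem dirichletCharacter_sum_re_mul_re {q : ℕ} [Fact q.Prime] {n m : ℕ}
    (hn : n ∈ Finset.Ioo 0 q) (hm : m ∈ Finset.Ioo 0 q) :
    ∑ χ : DirichletCharacter ℂ q,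
      (χ n + (starRingEnd ℂ) (χ n)).re * (χ m + (starRingEnd ℂ) (χ m)).re =
    2 * (q - 1) * ((if n = m then 1 else 0) + (if n * m % q = 1 then 1 else 0)) := by
  have hprime : q.Prime := Fact.out
  rw [Finset.mem_Ioo] at hn hm
  have hn0 : (n : ZMod q) ≠ 0 := fun h =>
    absurd (Nat.le_of_dvd hn.1 ((ZMod.natCast_eq_zero_iff n q).mp h)) (by omega)
  have hre : ∀ χ : DirichletCharacter ℂ q,
      (χ n + (starRingEnd ℂ) (χ n)).re * (χ m + (starRingEnd ℂ) (χ m)).re =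
      2 * (χ ((n : ZMod q)⁻¹) * χ m + χ ((n : ZMod q) * m)).re := by
    intro χ
    rw [← MulChar.inv_apply', ← MulChar.star_apply', map_mul]
    simp only [Complex.add_re, Complex.mul_re, Complex.star_def, Complex.conj_re,
      Complex.conj_im]
    ring
  simp only [hre]
  rw [← Finset.mul_sum, ← Complex.re_sum, Finset.sum_add_distrib,
    DirichletCharacter.sum_char_inv_mul_char_eq ℂ (isUnit_iff_ne_zero.mpr hn0),
    DirichletCharacter.sum_characters_eq, Nat.totient_prime hprime]
  have h1 : ((n : ZMod q) = m) ↔ n = m := by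
    rw [ZMod.natCast_eq_natCast_iff', Nat.mod_eq_of_lt hn.2, Nat.mod_eq_of_lt hm.2]
  have h2 : ((n : ZMod q) * m = 1) ↔ n * m % q = 1 := by
    rw [← Nat.cast_mul, ← Nat.cast_one, ZMod.natCast_eq_natCast_iff',
      Nat.mod_eq_of_lt hprime.one_lt]
  have h3 : ((q - 1 : ℕ) : ℂ) = ((q - 1 : ℝ) : ℂ) := by
    rw [Nat.cast_sub hprime.one_lt.le]
    push_cast
    ring
  simp only [h1, h2, h3]
  split_ifs <;> simp
  ring

/-- The second moment over all characters modulo a prime. -/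
theorem dirichletCharacter_sum_sq {q : ℕ} [Fact q.Prime] (a : ℕ → ℝ) :
    ∑ χ : DirichletCharacter ℂ q,
      (∑ n ∈ Finset.Ioo 0 q, a n * (χ n + (starRingEnd ℂ) (χ n)).re) ^ 2 =
    2 * (q - 1) * (∑ n ∈ Finset.Ioo 0 q, a n ^ 2 +
      ∑ p ∈ (Finset.Ioo 0 q ×ˢ Finset.Ioo 0 q).filter (fun p : ℕ × ℕ => p.1 * p.2 % q = 1),
        a p.1 * a p.2) := by
  have hexp : ∀ χ : DirichletCharacter ℂ q,
      (∑ n ∈ Finset.Ioo 0 q, a n * (χ n + (starRingEnd ℂ) (χ n)).re) ^ 2 =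
      ∑ n ∈ Finset.Ioo 0 q, ∑ m ∈ Finset.Ioo 0 q, a n * a m *
        ((χ n + (starRingEnd ℂ) (χ n)).re * (χ m + (starRingEnd ℂ) (χ m)).re) := by
    intro χ
    rw [sq, Finset.sum_mul_sum]
    exact Finset.sum_congr rfl fun n _ => Finset.sum_congr rfl fun m _ => by ring
  simp only [hexp]
  rw [Finset.sum_comm]
  have hswap : ∀ n ∈ Finset.Ioo 0 q, ∑ χ : DirichletCharacter ℂ q, ∑ m ∈ Finset.Ioo 0 q,
      a n * a m * ((χ n + (starRingEnd ℂ) (χ n)).re * (χ m + (starRingEnd ℂ) (χ m)).re) =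
      2 * (q - 1) * (a n ^ 2 + ∑ m ∈ Finset.Ioo 0 q,
        if n * m % q = 1 then a n * a m else 0) := by
    intro n hn
    rw [Finset.sum_comm]
    have : ∀ m ∈ Finset.Ioo 0 q, ∑ χ : DirichletCharacter ℂ q,
        a n * a m * ((χ n + (starRingEnd ℂ) (χ n)).re * (χ m + (starRingEnd ℂ) (χ m)).re) =
        2 * (q - 1) * ((if n = m then a n * a m else 0) +
          (if n * m % q = 1 then a n * a m else 0)) := by
      intro m hm
      rw [← Finset.mul_sum, dirichletCharacter_sum_re_mul_re hn hm]
      split_ifs <;> ring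
    rw [Finset.sum_congr rfl this, ← Finset.mul_sum, Finset.sum_add_distrib,
      Finset.sum_ite_eq, if_pos hn, sq]
  rw [Finset.sum_congr rfl hswap, ← Finset.mul_sum, Finset.sum_add_distrib, Finset.sum_filter,
    Finset.sum_product]

theorem Wosc_eq_sum {q : ℕ} (hq : 2 ≤ q) {fhat : ℝ → ℝ} (hfhat : ∀ u, 1 ≤ u → fhat u = 0)
    (χ : DirichletCharacter ℂ q) :
    Wosc q fhat χ = -(1 / Real.log q) * ∑ n ∈ Finset.Ioo 0 q,
      Λ n / Real.sqrt n * fhat (Real.log n / Real.log q) * (χ n + (starRingEnd ℂ) (χ n)).re := by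
  have hL : 0 < Real.log q := Real.log_pos (by exact_mod_cast hq)
  rw [Wosc, tsum_eq_sum]
  intro n hn
  rcases Nat.eq_zero_or_pos n with rfl | hpos
  · simp
  · have hqn : q ≤ n := by
      by_contra h
      exact hn (Finset.mem_Ioo.mpr ⟨hpos, not_le.mp h⟩)
    rw [hfhat, mul_zero, zero_mul]
    rw [one_le_div hL]
    exact Real.log_le_log (by positivity) (by exact_mod_cast hqn)

theorem sum_Wosc_sq {q : ℕ} [Fact q.Prime] {fhat : ℝ → ℝ} (hfhat : ∀ u, 1 ≤ u → fhat u = 0) :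
    ∑ χ : DirichletCharacter ℂ q, Wosc q fhat χ ^ 2 =
      2 * (q - 1) * ((1 / Real.log q ^ 2) *
        ∑ n ∈ Finset.Ioc 0 q, Λ n ^ 2 / n * fhat (Real.log n / Real.log q) ^ 2 +
      (1 / Real.log q ^ 2) *
        ∑ p ∈ (Finset.Ioo 0 q ×ˢ Finset.Ioo 0 q).filter (fun p : ℕ × ℕ => p.1 * p.2 % q = 1),
        (Λ p.1 / Real.sqrt p.1 * fhat (Real.log p.1 / Real.log q)) *
          (Λ p.2 / Real.sqrt p.2 * fhat (Real.log p.2 / Real.log q))) := by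
  have hq : 2 ≤ q := (Fact.out : q.Prime).two_le
  have hL : 0 < Real.log q := Real.log_pos (by exact_mod_cast hq)
  have hdiag : ∑ n ∈ Finset.Ioc 0 q, Λ n ^ 2 / n * fhat (Real.log n / Real.log q) ^ 2 =
      ∑ n ∈ Finset.Ioo 0 q, (Λ n / Real.sqrt n * fhat (Real.log n / Real.log q)) ^ 2 := by
    rw [← Finset.sum_subset Finset.Ioo_subset_Ioc_self]
    · refine Finset.sum_congr rfl fun n _ => ?_
      rw [mul_pow, div_pow, Real.sq_sqrt n.cast_nonneg]
    · intro n hn hn'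
      have : n = q := by
        simp only [Finset.mem_Ioc, Finset.mem_Ioo] at hn hn'
        omega
      rw [this, div_self hL.ne', hfhat 1 le_rfl]
      ring
  simp only [Wosc_eq_sum hq hfhat, mul_pow]
  rw [← Finset.mul_sum, dirichletCharacter_sum_sq
    (fun n => Λ n / Real.sqrt n * fhat (Real.log n / Real.log q)), hdiag]
  ring

theorem abs_Wosc_le {q : ℕ} (hq : 2 ≤ q) {fhat : ℝ → ℝ} (hfhat : ∀ u, 1 ≤ u → fhat u = 0)
    (χ : DirichletCharacter ℂ q) :
    |Wosc q fhat χ| ≤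
      2 * ∑ n ∈ Finset.Ioc 0 q, |fhat (Real.log n / Real.log q)| / Real.sqrt n := by
  have hL : 0 < Real.log q := Real.log_pos (by exact_mod_cast hq)
  rw [Wosc_eq_sum hq hfhat, abs_mul, abs_neg, abs_of_pos (by positivity)]
  have hbound : |∑ n ∈ Finset.Ioo 0 q, Λ n / Real.sqrt n * fhat (Real.log n / Real.log q) *
      (χ n + (starRingEnd ℂ) (χ n)).re| ≤
      ∑ n ∈ Finset.Ioc 0 q,
        (2 * Real.log q) * (|fhat (Real.log n / Real.log q)| / Real.sqrt n) := by
    refine (Finset.abs_sum_le_sum_abs _ _).trans ((Finset.sum_le_sum fun n hn => ?_).trans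
      (Finset.sum_le_sum_of_subset_of_nonneg Finset.Ioo_subset_Ioc_self
        fun _ _ _ => by positivity))
    rw [Finset.mem_Ioo] at hn
    have hΛ : Λ n ≤ Real.log q := vonMangoldt_le_log.trans
      (Real.log_le_log (by exact_mod_cast hn.1) (by exact_mod_cast hn.2.le))
    have hre : |(χ n + (starRingEnd ℂ) (χ n)).re| ≤ 2 := by
      rw [Complex.add_re, Complex.conj_re, ← two_mul, abs_mul, abs_two]
      have := (Complex.abs_re_le_norm (χ n)).trans (χ.norm_le_one n)
      linarith
    rw [abs_mul, abs_mul, abs_div, abs_of_nonneg (vonMangoldt_nonneg (n := n)),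
      abs_of_nonneg (Real.sqrt_nonneg _)]
    calc _ ≤ Real.log q / Real.sqrt n * |fhat (Real.log n / Real.log q)| * 2 := by gcongr
      _ = _ := by ring
  rw [← Finset.mul_sum] at hbound
  calc _ ≤ _ := mul_le_mul_of_nonneg_left hbound (by positivity)
    _ = _ := by field_simp

theorem charAvg_eq_sub {q : ℕ} [NeZero q] (H : DirichletCharacter ℂ q → ℝ) :
    charAvg q H = (1 / (q - 2 : ℝ)) * (∑ χ : DirichletCharacter ℂ q, H χ - H 1) := by
  classical
  rw [charAvg, ← Finset.sum_erase_eq_sub (Finset.mem_univ _), ← Finset.filter_ne']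
  congr!

theorem integral_abs_mul_of_even {h : ℝ → ℝ} (hh : Continuous h) (heven : ∀ u, h (-u) = h u) :
    ∫ u in (-1 : ℝ)..1, |u| * h u = 2 * ∫ u in (0 : ℝ)..1, u * h u := by
  have hc : Continuous fun u => |u| * h u := by fun_prop
  have hpos : ∫ u in (0 : ℝ)..1, |u| * h u = ∫ u in (0 : ℝ)..1, u * h u := by
    refine intervalIntegral.integral_congr fun u hu => ?_
    rw [Set.uIcc_of_le zero_le_one] at hu
    simp only [abs_of_nonneg hu.1]
  have hneg : ∫ u in (-1 : ℝ)..0, |u| * h u = ∫ u in (0 : ℝ)..1, |u| * h u := by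
    have := intervalIntegral.integral_comp_neg (a := 0) (b := 1) (fun u => |u| * h u)
    simp only [abs_neg, heven, neg_zero] at this
    exact this.symm
  rw [← intervalIntegral.integral_add_adjacent_intervals (hc.intervalIntegrable _ 0)
    (hc.intervalIntegrable _ _), hneg, hpos]
  ring

theorem tendsto_charAvg_Wosc_sq_of_even {g : ℝ → ℝ} (hcont : Continuous g)
    (heven : ∀ u, g (-u) = g u) (hg : ∀ u, 1 ≤ u → g u = 0) :
    Tendsto (fun q : ℕ => charAvg q (fun χ => (Wosc q g χ) ^ 2))
      (atTop ⊓ Filter.principal {q : ℕ | q.Prime ∧ Odd q})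
      (nhds (∫ u in (-1 : ℝ)..1, |u| * g u ^ 2)) := by
  have hg1 : g 1 = 0 := hg 1 le_rfl
  have hD := tendsto_sum_vonMangoldt_sq_div_mul (h := fun u => g u ^ 2) (by fun_prop)
  have hO : Tendsto (fun q : ℕ => (1 / Real.log q ^ 2) *
      ∑ p ∈ (Finset.Ioo 0 q ×ˢ Finset.Ioo 0 q).filter (fun p : ℕ × ℕ => p.1 * p.2 % q = 1),
        (Λ p.1 / Real.sqrt p.1 * g (Real.log p.1 / Real.log q)) *
          (Λ p.2 / Real.sqrt p.2 * g (Real.log p.2 / Real.log q))) atTop (nhds 0) := by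
    refine squeeze_zero_norm (fun q => ?_) (tendsto_sum_offDiag hcont hg1)
    rw [Real.norm_eq_abs, abs_mul, abs_of_nonneg (by positivity)]
    gcongr
    exact (Finset.abs_sum_le_sum_abs _ _).trans (Finset.sum_le_sum_of_subset_of_nonneg
      (Finset.filter_subset_filter _ (Finset.product_subset_product
        Finset.Ioo_subset_Ioc_self Finset.Ioo_subset_Ioc_self)) fun _ _ _ => abs_nonneg _)
  have hT := tendsto_sum_abs_div_sqrt hcont hg1
  have hratio : Tendsto (fun q : ℕ => 1 + 1 / ((q : ℝ) - 2)) atTop (nhds 1) := by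
    have : Tendsto (fun q : ℕ => (q : ℝ) - 2) atTop atTop :=
      tendsto_atTop_add_const_right _ (-2) tendsto_natCast_atTop_atTop
    simpa using (this.const_div_atTop 1).const_add 1
  have hW : Tendsto (fun q : ℕ => (1 / ((q : ℝ) - 2)) * Wosc q g 1 ^ 2) atTop (nhds 0) := by
    have hT2 : Tendsto (fun q : ℕ => 12 * ((1 / Real.sqrt q) *
        ∑ n ∈ Finset.Ioc 0 q, |g (Real.log n / Real.log q)| / Real.sqrt n) ^ 2)
        atTop (nhds 0) := by
      simpa using (hT.pow 2).const_mul 12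
    refine squeeze_zero' ?_ ?_ hT2
    · filter_upwards [eventually_ge_atTop 3] with q hq
      have : (3 : ℝ) ≤ q := by exact_mod_cast hq
      exact mul_nonneg (one_div_nonneg.mpr (by linarith)) (sq_nonneg _)
    · filter_upwards [eventually_ge_atTop 3] with q hq
      have hq3 : (3 : ℝ) ≤ q := by exact_mod_cast hq
      have h1 := abs_Wosc_le (by omega : 2 ≤ q) hg 1
      set s := ∑ n ∈ Finset.Ioc 0 q, |g (Real.log n / Real.log q)| / Real.sqrt n
      have h2 : Wosc q g 1 ^ 2 ≤ (2 * s) ^ 2 := by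
        rw [← sq_abs]
        gcongr
      have h3 : 1 / ((q : ℝ) - 2) ≤ 3 / q := by
        rw [div_le_div_iff₀ (by linarith) (by linarith)]
        linarith
      calc _ ≤ 3 / q * (2 * s) ^ 2 :=
            mul_le_mul h3 h2 (sq_nonneg _) (by positivity)
        _ = _ := by
            rw [mul_pow (1 / Real.sqrt q), div_pow, Real.sq_sqrt (by linarith)]
            ring
  have hmain := ((hratio.mul ((hD.add hO).const_mul 2)).sub hW).mono_left
    (inf_le_left : atTop ⊓ Filter.principal {q : ℕ | q.Prime ∧ Odd q} ≤ atTop)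
  rw [integral_abs_mul_of_even (h := fun u => g u ^ 2) (by fun_prop) (fun u => by rw [heven])]
  simp only [one_mul, add_zero, sub_zero] at hmain
  refine hmain.congr' ?_
  filter_upwards [mem_inf_of_right (mem_principal_self _),
    mem_inf_of_left (eventually_ge_atTop 3)] with q hqp hq3
  have : Fact q.Prime := ⟨hqp.1⟩
  have hq3' : (3 : ℝ) ≤ q := by exact_mod_cast hq3
  have hne : (q : ℝ) - 2 ≠ 0 := by linarith
  rw [charAvg_eq_sub, sum_Wosc_sq hg]
  field_simp
  ring

/-- Variance of the linear statistic: if `f` is real and even with `f̂` continuous and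
supported in `[-1,1]`, then `⟨(W_f^osc)²⟩_q → ∫_{-1}^{1} |u| f̂(u)² du` as `q → ∞`
through odd primes. -/
theorem charAvg_Wosc_sq_tendsto (f fhat : ℝ → ℝ) (heven : ∀ x, f (-x) = f x)
    (hcont : Continuous fhat)
    (hsupp : Function.support fhat ⊆ Set.Icc (-1 : ℝ) 1)
    (hfourier : ∀ u : ℝ, (fhat u : ℂ) =
      ∫ x : ℝ, (f x : ℂ) * Complex.exp (-(2 * Real.pi * Complex.I) * x * u)) :
    Tendsto (fun q : ℕ => charAvg q (fun χ => (Wosc q fhat χ) ^ 2))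
      (atTop ⊓ Filter.principal {q : ℕ | q.Prime ∧ Odd q})
      (nhds (∫ u in (-1 : ℝ)..1, |u| * fhat u ^ 2)) := by
  have hfhat_even : ∀ u, fhat (-u) = fhat u := by
    intro u
    have h : (fhat (-u) : ℂ) = fhat u := by
      rw [hfourier, hfourier, ← MeasureTheory.integral_neg_eq_self]
      refine MeasureTheory.integral_congr_ae (Eventually.of_forall fun x => ?_)
      simp only [heven]
      push_cast
      ring_nf
    exact_mod_cast h
  have hzero : ∀ u, 1 < u → fhat u = 0 := fun u hu => by
    by_contra h
    exact absurd (hsupp h).2 (not_le.mpr hu)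
  have hone : fhat 1 = 0 := by
    refine tendsto_nhds_unique (hcont.continuousWithinAt (s := Set.Ioi 1) (x := 1)) ?_
    exact tendsto_const_nhds.congr'
      (eventually_nhdsWithin_of_forall fun u hu => (hzero u hu).symm)
  exact tendsto_charAvg_Wosc_sq_of_even hcont hfhat_even fun u hu =>
    hu.eq_or_lt.elim (fun h => h ▸ hone) (hzero u)
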